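/- The boundary limit of the Dirichlet solution: for any boundary point (cos θ, sin θ) of the unit circle with sin θ > 0, the function u(x₁,x₂) = 1/2 + (1/π)·arctan(2x₂/(1 - x₁² - x₂²)) tends to 1 as (x₁,x₂) tends to (cos θ, sin θ) from inside the unit disk; if sin θ < 0, u tends to 0. -/

import Mathlib

open Real Filter

/-- Boundary limits of the Dirichlet solution `u(x₁,x₂) = 1/2 + (1/π)·arctan(2x₂/(1-x₁²-x₂²))`:
approaching a boundary point `(cos θ, sin θ)` from inside the unit disk, `u → 1` where
`sin θ > 0` and `u → 0` where `sin θ < 0`. -/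
theorem dirichlet_boundary_limit (θ : ℝ) :
    (sin θ > 0 →
      Tendsto (fun p : ℝ × ℝ =>
          1 / 2 + (1 / π) * arctan (2 * p.2 / (1 - p.1 ^ 2 - p.2 ^ 2)))
        (nhdsWithin (cos θ, sin θ) {p : ℝ × ℝ | p.1 ^ 2 + p.2 ^ 2 < 1}) (nhds 1)) ∧
    (sin θ < 0 →
      Tendsto (fun p : ℝ × ℝ =>
          1 / 2 + (1 / π) * arctan (2 * p.2 / (1 - p.1 ^ 2 - p.2 ^ 2)))
        (nhdsWithin (cos θ, sin θ) {p : ℝ × ℝ | p.1 ^ 2 + p.2 ^ 2 < 1}) (nhds 0)) := by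
  set l := nhdsWithin (cos θ, sin θ) {p : ℝ × ℝ | p.1 ^ 2 + p.2 ^ 2 < 1} with hl
  have hden : Tendsto (fun p : ℝ × ℝ => (1 - p.1 ^ 2 - p.2 ^ 2)⁻¹) l atTop := by
    apply Tendsto.inv_tendsto_nhdsGT_zero
    apply tendsto_nhdsWithin_iff.mpr
    constructor
    · have hc : Continuous (fun p : ℝ × ℝ => 1 - p.1 ^ 2 - p.2 ^ 2) := by fun_prop
      have h := hc.tendsto (cos θ, sin θ)
      have h0 : 1 - cos θ ^ 2 - sin θ ^ 2 = 0 := by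
        linarith [sin_sq_add_cos_sq θ]
      simp only [h0] at h
      exact h.mono_left nhdsWithin_le_nhds
    · filter_upwards [self_mem_nhdsWithin] with p hp
      have hp' : p.1 ^ 2 + p.2 ^ 2 < 1 := hp
      show 0 < 1 - p.1 ^ 2 - p.2 ^ 2
      linarith
  have hnum : Tendsto (fun p : ℝ × ℝ => 2 * p.2) l (nhds (2 * sin θ)) := by
    have hc : Continuous (fun p : ℝ × ℝ => 2 * p.2) := by fun_prop
    exact (hc.tendsto (cos θ, sin θ)).mono_left nhdsWithin_le_nhds
  constructor
  · intro hs
    have h1 : Tendsto (fun p : ℝ × ℝ => 2 * p.2 / (1 - p.1 ^ 2 - p.2 ^ 2)) l atTop := by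
      simpa only [div_eq_mul_inv] using hnum.pos_mul_atTop (by linarith) hden
    have h2 := (tendsto_arctan_atTop.mono_right nhdsWithin_le_nhds).comp h1
    have h3 := (h2.const_mul (1 / π)).const_add (1 / 2)
    have e : 1 / 2 + 1 / π * (π / 2) = 1 := by
      field_simp [pi_ne_zero]
      norm_num
    rw [e] at h3
    exact h3
  · intro hs
    have h1 : Tendsto (fun p : ℝ × ℝ => 2 * p.2 / (1 - p.1 ^ 2 - p.2 ^ 2)) l atBot := by
      simpa only [div_eq_mul_inv] using hnum.neg_mul_atTop (by linarith) hden
    have h2 := (tendsto_arctan_atBot.mono_right nhdsWithin_le_nhds).comp h1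
    have h3 := (h2.const_mul (1 / π)).const_add (1 / 2)
    have e : 1 / 2 + 1 / π * (-(π / 2)) = 0 := by
      field_simp [pi_ne_zero]
      norm_num
    rw [e] at h3
    exact h3
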